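/- arXiv:2005.00089 — 4 statements merged into one kernel-verified Lean document; each statement's English description precedes it below -/
import Mathlib

section
/- Let M₀ = (E₀, H) be a simple binary matroid with H a hyperplane of G, let w ∈ G \ H with w ∉ E₀ + ... (i.e. the doubling M of M₀ by w has ground set E = E₀ ∪ (w + E₀) with w ∉ E). Then χ(M) = χ(M₀), where χ denotes the critical number. -/
/-- A vector of `H` in the span of `W ≤ H` and a vector outside `H` already lies in `W`. -/
theorem Submodule.mem_of_mem_sup_span_singleton {K V : Type*} [Field K] [AddCommGroup V]
    [Module K V] {H W : Submodule K V} (hW : W ≤ H) {w : V} (hw : w ∉ H) {z : V} (hz : z ∈ H)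
    (hzW : z ∈ W ⊔ K ∙ w) : z ∈ W := by
  obtain ⟨a, ha, b, hb, rfl⟩ := Submodule.mem_sup.1 hzW
  obtain ⟨c, rfl⟩ := Submodule.mem_span_singleton.1 hb
  have hc : c • w ∈ H := (H.add_mem_iff_right (hW ha)).1 hz
  rcases eq_or_ne c 0 with rfl | h0
  · simpa using ha
  · exact absurd ((H.smul_mem_iff h0).1 hc) hw

/-- Adjoining a vector outside `W` raises the dimension by one. -/
theorem Submodule.finrank_sup_span_singleton_of_notMem {K V : Type*} [Field K] [AddCommGroup V]
    [Module K V] [FiniteDimensional K V] {W : Submodule K V} {w : V} (hw : w ∉ W) :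
    Module.finrank K ↥(W ⊔ K ∙ w) = Module.finrank K W + 1 := by
  have h0 : w ≠ 0 := fun h => hw (h ▸ W.zero_mem)
  have hdisj : W ⊓ K ∙ w = ⊥ :=
    disjoint_iff.1 ((Submodule.disjoint_span_singleton' h0).2 hw)
  have h := Submodule.finrank_sup_add_finrank_inf_eq W (K ∙ w)
  rw [hdisj, finrank_bot, finrank_span_singleton h0] at h
  exact h


/-- doubling preserves the critical number. Here `M₀ = (E₀, H)` lives on a
hyperplane `H` of the `n`-dimensional geometry `G = V \ {0}`, `w ∈ G \ H`, and the doubling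
`M` has ground set `E = E₀ ∪ (w + E₀)`. The critical number is the ambient dimension minus
the largest dimension of a subspace whose nonzero vectors avoid the ground set (for `M₀`,
subspaces contained in `H`). -/
theorem stmt5 {V : Type*} [AddCommGroup V] [Module (ZMod 2) V]
    [FiniteDimensional (ZMod 2) V]
    (H : Submodule (ZMod 2) V)
    (hH : Module.finrank (ZMod 2) V = Module.finrank (ZMod 2) H + 1)
    (E₀ : Set V) (hE₀ : E₀ ⊆ (H : Set V) \ {0}) (w : V) (hw : w ∉ H) :
    Module.finrank (ZMod 2) V -
        sSup {k : ℕ | ∃ W : Submodule (ZMod 2) V, Module.finrank (ZMod 2) W = k ∧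
          ((W : Set V) \ {0}) ∩ (E₀ ∪ (fun z => w + z) '' E₀) = ∅} =
      Module.finrank (ZMod 2) H -
        sSup {k : ℕ | ∃ W : Submodule (ZMod 2) V, W ≤ H ∧ Module.finrank (ZMod 2) W = k ∧
          ((W : Set V) \ {0}) ∩ E₀ = ∅} := by
  set A := {k : ℕ | ∃ W : Submodule (ZMod 2) V, Module.finrank (ZMod 2) W = k ∧
    ((W : Set V) \ {0}) ∩ (E₀ ∪ (fun z => w + z) '' E₀) = ∅}
  set B := {k : ℕ | ∃ W : Submodule (ZMod 2) V, W ≤ H ∧ Module.finrank (ZMod 2) W = k ∧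
    ((W : Set V) \ {0}) ∩ E₀ = ∅}
  have hA : BddAbove A := ⟨Module.finrank (ZMod 2) V, by
    rintro _ ⟨W, rfl, -⟩
    exact Submodule.finrank_le W⟩
  have hB : BddAbove B := ⟨Module.finrank (ZMod 2) V, by
    rintro _ ⟨W, -, rfl, -⟩
    exact Submodule.finrank_le W⟩
  have hA0 : A.Nonempty := ⟨0, ⊥, finrank_bot _ _, by simp⟩
  have hB0 : B.Nonempty := ⟨0, ⊥, bot_le, finrank_bot _ _, by simp⟩
  have hle : sSup A ≤ sSup B + 1 := by
    refine csSup_le hA0 ?_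
    rintro _ ⟨U, rfl, hU⟩
    have hmem : Module.finrank (ZMod 2) ↥(U ⊓ H) ∈ B := by
      refine ⟨U ⊓ H, inf_le_right, rfl, Set.subset_eq_empty ?_ hU⟩
      exact Set.inter_subset_inter (Set.sdiff_subset_sdiff_left fun x hx => hx.1)
        Set.subset_union_left
    have hinf := le_csSup hB hmem
    have hdim := Submodule.finrank_sup_add_finrank_inf_eq U H
    have hsup := Submodule.finrank_le (U ⊔ H)
    omega
  have hge : sSup B + 1 ≤ sSup A := by
    obtain ⟨W, hWH, hdim, hW⟩ := Nat.sSup_mem hB0 hB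
    rw [← hdim, ← Submodule.finrank_sup_span_singleton_of_notMem fun h => hw (hWH h)]
    refine le_csSup hA ⟨_, rfl, ?_⟩
    have havoid : ∀ z ∈ E₀, z ∉ W ⊔ (ZMod 2) ∙ w := fun z hz hzW =>
      Set.eq_empty_iff_forall_notMem.1 hW z
        ⟨⟨Submodule.mem_of_mem_sup_span_singleton hWH hw (hE₀ hz).1 hzW, (hE₀ hz).2⟩, hz⟩
    rw [Set.eq_empty_iff_forall_notMem]
    rintro _ ⟨⟨hx, -⟩, hz | ⟨z, hz, rfl⟩⟩
    · exact havoid _ hz hx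
    · exact havoid z hz ((Submodule.add_mem_iff_right _
        (Submodule.mem_sup_right (Submodule.mem_span_singleton_self w))).1 hx)
  omega
end

section
/- Let N be a simple binary matroid that is not a doubling of another matroid (i.e., there is no nonzero w outside the ground set of N with w + E_N = E_N). If M₀ contains no induced N-restriction, then any doubling M of M₀ contains no induced N-restriction. -/
/-- Over `ZMod 2`, a hyperplane is the kernel of a functional taking the value `1` at any given
vector outside it. -/
theorem exists_functional_of_hyperplane {V : Type*} [AddCommGroup V] [Module (ZMod 2) V]
    [FiniteDimensional (ZMod 2) V] (H : Submodule (ZMod 2) V)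
    (hH : Module.finrank (ZMod 2) V = Module.finrank (ZMod 2) H + 1) (w : V) (hw : w ∉ H) :
    ∃ f : V →ₗ[ZMod 2] ZMod 2, f w = 1 ∧ ∀ v, f v = 0 ↔ v ∈ H := by
  obtain ⟨f, hfw, hHf⟩ := H.exists_le_ker_of_notMem hw
  have hker : LinearMap.ker f < ⊤ := lt_top_iff_ne_top.2 fun h => hfw (by
    rw [← LinearMap.mem_ker, h]; trivial)
  have hlt := Submodule.finrank_lt hker.ne
  have heq : H = LinearMap.ker f := Submodule.eq_of_le_of_finrank_le hHf (by omega)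
  refine ⟨f, ?_, fun v => by rw [heq, LinearMap.mem_ker]⟩
  exact Fin.eq_one_of_ne_zero _ hfw

/-- let `N = (EN, Wsp \ {0})` be a simple binary matroid (on the `GF(2)` space
`Wsp`) that is not a doubling (no nonzero `w ∉ EN` with `w + EN = EN`).  If `M₀ = (E₀, H)`
(on a hyperplane `H` of `V`) has no induced `N`-restriction, then neither does the doubling
`M = (E₀ ∪ (w + E₀), V \ {0})` of `M₀` by `w ∈ (V \ {0}) \ (H ∪ E₀)`.  An induced
`N`-restriction is a flat (subspace) `F` together with a linear isomorphism of `Wsp` onto `F`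
carrying `EN` onto the intersection of the ground set with `F \ {0}`. -/
theorem stmt6 {V Wsp : Type*} [AddCommGroup V] [Module (ZMod 2) V]
    [FiniteDimensional (ZMod 2) V]
    [AddCommGroup Wsp] [Module (ZMod 2) Wsp] [FiniteDimensional (ZMod 2) Wsp]
    (EN : Set Wsp) (hEN : EN ⊆ {v : Wsp | v ≠ 0})
    (hNnotdouble : ¬ ∃ w : Wsp, w ≠ 0 ∧ w ∉ EN ∧ (fun x => w + x) '' EN = EN)
    (H : Submodule (ZMod 2) V)
    (hH : Module.finrank (ZMod 2) V = Module.finrank (ZMod 2) H + 1)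
    (E₀ : Set V) (hE₀ : E₀ ⊆ (H : Set V) \ {0}) (w : V) (hw : w ∉ H)
    (hM₀ : ¬ ∃ F : Submodule (ZMod 2) V, F ≤ H ∧ ∃ φ : Wsp ≃ₗ[ZMod 2] ↥F,
        (fun v => ((φ v : F) : V)) '' EN = E₀ ∩ ((F : Set V) \ {0})) :
    ¬ ∃ F : Submodule (ZMod 2) V, ∃ φ : Wsp ≃ₗ[ZMod 2] ↥F,
        (fun v => ((φ v : F) : V)) '' EN =
          (E₀ ∪ (fun z => w + z) '' E₀) ∩ ((F : Set V) \ {0}) := by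
  obtain ⟨f, hfw, hf⟩ := exists_functional_of_hyperplane H hH w hw
  have hchar : ∀ v : V, v + v = 0 := ZModModule.add_self
  have hww : ∀ v : V, w + (w + v) = v := fun v => by rw [← add_assoc, hchar, zero_add]
  set E : Set V := E₀ ∪ (fun z => w + z) '' E₀ with hE
  have hE₀H : ∀ v ∈ E₀, f v = 0 := fun v hv => (hf v).2 (hE₀ hv).1
  have hE₀0 : ∀ v ∈ E₀, v ≠ 0 := fun v hv => (hE₀ hv).2
  have hmem : ∀ v, v ∈ E ↔ v + f v • w ∈ E₀ := by
    intro v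
    constructor
    · rintro (hv | ⟨z, hz, rfl⟩)
      · simpa [hE₀H v hv] using hv
      · simpa [hE₀H z hz, hfw, add_comm _ w, hww] using hz
    · intro hv
      by_cases h : f v = 0
      · exact Or.inl (by simpa [h] using hv)
      · have h1 : f v = 1 := Fin.eq_one_of_ne_zero _ h
        refine Or.inr ⟨v + w, by simpa [h1] using hv, ?_⟩
        simp only [add_comm v w, hww]
  have hzero : (0 : V) ∉ E := fun h => hE₀0 _ ((hmem 0).1 h) (by simp)
  have hwE : w ∉ E := fun h => hE₀0 _ ((hmem w).1 h) (by simp [hfw, hchar])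
  have hshift : ∀ v ∈ E, w + v ∈ E := by
    rintro v (hv | ⟨z, hz, rfl⟩)
    · exact Or.inr ⟨v, hv, rfl⟩
    · exact Or.inl (by simpa only [hww] using hz)
  rintro ⟨F, φ, hφ⟩
  have hEN' : ∀ x, x ∈ EN ↔ (φ x : V) ∈ E := by
    intro x
    constructor
    · intro hx
      have : (φ x : V) ∈ E ∩ ((F : Set V) \ {0}) := hφ ▸ ⟨x, hx, rfl⟩
      exact this.1
    · intro hx
      have : (φ x : V) ∈ E ∩ ((F : Set V) \ {0}) :=
        ⟨hx, (φ x).2, fun h => hzero (by rw [Set.mem_singleton_iff] at h; rwa [h] at hx)⟩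
      rw [← hφ] at this
      obtain ⟨y, hy, hyx⟩ := this
      rwa [← φ.injective (Subtype.ext hyx)]
  by_cases hwF : w ∈ F
  · have hu : (φ (φ.symm ⟨w, hwF⟩) : V) = w := by simp
    generalize φ.symm ⟨w, hwF⟩ = u at hu
    have hsub : ∀ x ∈ EN, u + x ∈ EN := fun x hx => by
      rw [hEN', map_add, Submodule.coe_add, hu]
      exact hshift _ ((hEN' x).1 hx)
    refine hNnotdouble ⟨u, ?_, ?_, ?_⟩
    · rintro rfl
      exact hw (by rw [← hu]; simp)
    · rw [hEN', hu]
      exact hwE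
    · refine Set.Subset.antisymm (by rintro _ ⟨x, hx, rfl⟩; exact hsub x hx) fun x hx =>
        ⟨u + x, hsub x hx, ?_⟩
      simp only [← add_assoc, ZModModule.add_self, zero_add]
  · let g : Wsp →ₗ[ZMod 2] V := (LinearMap.id + f.smulRight w) ∘ₗ F.subtype ∘ₗ φ.toLinearMap
    have hg : ∀ x, g x = (φ x : V) + f (φ x) • w := fun x => rfl
    have hinj : Function.Injective g := by
      rw [injective_iff_map_eq_zero]
      intro x hx
      rw [hg] at hx
      by_cases h : f (φ x) = 0
      · simpa [h] using hx
      · have h1 : f (φ x) = 1 := Fin.eq_one_of_ne_zero _ h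
        rw [h1, one_smul] at hx
        refine absurd ?_ hwF
        rw [eq_neg_of_add_eq_zero_right hx]
        exact F.neg_mem (φ x).2
    refine hM₀ ⟨LinearMap.range g, ?_, LinearEquiv.ofInjective g hinj, ?_⟩
    · rintro _ ⟨x, rfl⟩
      rw [← hf, hg, map_add, map_smul, hfw, smul_eq_mul, mul_one]
      exact ZModModule.add_self _
    · ext v
      constructor
      · rintro ⟨x, hx, rfl⟩
        have hgx : g x ∈ E₀ := by rw [hg, ← hmem]; exact (hEN' x).1 hx
        exact ⟨hgx, ⟨x, rfl⟩, hE₀0 _ hgx⟩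
      · rintro ⟨hv, ⟨x, rfl⟩, -⟩
        exact ⟨x, by rwa [hEN', hmem, ← hg], rfl⟩
end

section
/- Let s ≥ 4, let M = (E, G) be an affine, I_s-free simple binary matroid with hyperplane H satisfying E ⊆ G \ H, and let M' = (E', G') be the 1-expansion of M (G a hyperplane of G', x ∈ G' \ G, E' = E ∪ (x + H) ∪ {x}). Then M' is I_s-free. -/
/-- `E ∩ (W \ {0})` is a basis of the subspace `W` (independent and spanning `W`). -/
def MeetsInBasis {V : Type*} [AddCommGroup V] [Module (ZMod 2) V]
    (E : Set V) (W : Submodule (ZMod 2) V) : Prop :=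
  LinearIndependent (ZMod 2) ((↑) : ↥(E ∩ ((W : Set V) \ {0})) → V) ∧
    Submodule.span (ZMod 2) (E ∩ ((W : Set V) \ {0})) = W

/-- `I_s`-freeness: no `s`-dimensional subspace meets `E` in a basis of itself. -/
def IsFree {V : Type*} [AddCommGroup V] [Module (ZMod 2) V] (s : ℕ) (E : Set V) : Prop :=
  ∀ W : Submodule (ZMod 2) V, Module.finrank (ZMod 2) W = s → ¬ MeetsInBasis E W

/-- A linearly independent set contains no nondegenerate parallelogram
`y`, `y + a`, `y + b`, `y + a + b`. -/
lemma not_linearIndepOn_id_of_parallelogram {K V : Type*} [DivisionRing K] [AddCommGroup V]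
    [Module K V] {S : Set V} {y a b : V} (ha : a ≠ 0) (hb : b ≠ 0) (hab : a + b ≠ 0)
    (hy : y ∈ S) (hya : y + a ∈ S) (hyb : y + b ∈ S) (hyab : y + a + b ∈ S) :
    ¬ LinearIndepOn K id S := by
  intro hS
  have hmem {v : V} (hv : v ∈ S) (hne : v ≠ y) : v ∈ Submodule.span K (S \ {y}) :=
    Submodule.subset_span ⟨hv, hne⟩
  have hinsert : LinearIndepOn K id (insert y (S \ {y})) := by
    rwa [Set.insert_sdiff_self_of_mem hy]
  refine ((linearIndepOn_id_insert (by simp)).1 hinsert).2 ?_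
  have hsum : y = (y + a) + (y + b) - (y + a + b) := by abel
  have h := Submodule.sub_mem _
    (Submodule.add_mem _ (hmem hya (by simpa using ha)) (hmem hyb (by simpa using hb)))
    (hmem hyab (by simpa [add_assoc] using hab))
  rwa [← hsum] at h

/-- A space of dimension at least two contains `a` and `b` with `a`, `b` and `a + b` nonzero. -/
lemma exists_ne_zero_add_ne_zero_of_one_lt_finrank {K V : Type*} [DivisionRing K]
    [AddCommGroup V] [Module K V] (h : 1 < Module.finrank K V) :
    ∃ a b : V, a ≠ 0 ∧ b ≠ 0 ∧ a + b ≠ 0 := by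
  have := Module.nontrivial_of_finrank_pos (R := K) (M := V) (by omega)
  obtain ⟨a, ha⟩ := exists_ne (0 : V)
  obtain ⟨b, hab⟩ := exists_linearIndependent_pair_of_one_lt_finrank h ha
  rw [LinearIndependent.pair_iff] at hab
  refine ⟨a, b, ha, fun hb => ?_, fun hs => ?_⟩
  · simpa using hab 0 1 (by simp [hb])
  · simpa using hab 1 1 (by simpa using hs)

/-- for `s ≥ 4`, a 1-expansion of an affine `I_s`-free matroid is `I_s`-free.
Setup: `M = (E, G₀ \ {0})` affine with hyperplane `H` of `G₀`, `E ⊆ (G₀ \ {0}) \ H`;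
`G₀` a hyperplane of `V`, `x ∈ V \ G₀`, and `E' = E ∪ (x + (H \ {0})) ∪ {x}`. -/
theorem stmt8 {V : Type*} [AddCommGroup V] [Module (ZMod 2) V]
    [FiniteDimensional (ZMod 2) V] (s : ℕ) (hs : 4 ≤ s)
    (G₀ H : Submodule (ZMod 2) V)
    (hG₀ : Module.finrank (ZMod 2) V = Module.finrank (ZMod 2) G₀ + 1)
    (hHG : H ≤ G₀)
    (hH : Module.finrank (ZMod 2) G₀ = Module.finrank (ZMod 2) H + 1)
    (E : Set V) (hE : E ⊆ ((G₀ : Set V) \ {0}) \ (H : Set V))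
    (hIs : IsFree s E)
    (x : V) (hx : x ∉ G₀) :
    IsFree s (E ∪ (fun h => x + h) '' ((H : Set V) \ {0}) ∪ {x}) := by
  intro W hW hB
  set E' := E ∪ (fun h => x + h) '' ((H : Set V) \ {0}) ∪ {x} with hE'
  have hxH {h : V} (hh : h ∈ H) : x + h ∈ E' := by
    by_cases h0 : h = 0
    · simp [hE', h0]
    · exact Or.inl (Or.inr ⟨h, ⟨hh, h0⟩, rfl⟩)
  have hcoset {h : V} (hh : h ∈ H) (hw : x + h ∈ W) : x + h ∈ E' ∩ ((W : Set V) \ {0}) := by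
    refine ⟨hxH hh, hw, fun h0 => hx ?_⟩
    rw [eq_neg_of_add_eq_zero_left h0]
    exact G₀.neg_mem (hHG hh)
  by_cases hmeet : ∃ h ∈ H, x + h ∈ W
  · obtain ⟨h, hh, hw⟩ := hmeet
    have hdim : 1 < Module.finrank (ZMod 2) ↥(W ⊓ H) := by
      have h₁ := Submodule.finrank_sup_add_finrank_inf_eq W H
      have h₂ := Submodule.finrank_le (W ⊔ H)
      omega
    obtain ⟨⟨a, haW, haH⟩, ⟨b, hbW, hbH⟩, ha, hb, hab⟩ :=
      exists_ne_zero_add_ne_zero_of_one_lt_finrank hdim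
    refine not_linearIndepOn_id_of_parallelogram (K := ZMod 2) (y := x + h) (a := a) (b := b)
      (fun h0 => ha (Subtype.ext h0)) (fun h0 => hb (Subtype.ext h0))
      (fun h0 => hab (Subtype.ext h0)) (hcoset hh hw) ?_ ?_ ?_ hB.1
    · have hwa := W.add_mem hw haW
      rw [add_assoc] at hwa ⊢
      exact hcoset (H.add_mem hh haH) hwa
    · have hwb := W.add_mem hw hbW
      rw [add_assoc] at hwb ⊢
      exact hcoset (H.add_mem hh hbH) hwb
    · have hwab := W.add_mem (W.add_mem hw haW) hbW
      rw [add_assoc x, add_assoc x] at hwab ⊢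
      exact hcoset (H.add_mem (H.add_mem hh haH) hbH) hwab
  · have heq : E' ∩ ((W : Set V) \ {0}) = E ∩ ((W : Set V) \ {0}) := by
      refine subset_antisymm ?_
        (Set.inter_subset_inter_left _ (Set.subset_union_left.trans Set.subset_union_left))
      rintro w ⟨(hw | ⟨h, hh, rfl⟩) | rfl, hwW⟩
      · exact ⟨hw, hwW⟩
      · exact absurd ⟨h, hh.1, hwW.1⟩ hmeet
      · exact absurd ⟨0, H.zero_mem, by simpa using hwW.1⟩ hmeet
    refine hIs W hW ?_
    unfold MeetsInBasis at hB ⊢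
    rwa [heq] at hB
end

section
/- If M = (E, G) is an I₄-free and triangle-free simple binary matroid, then χ(M) ≤ 2; that is, G contains a subspace W with codimension at most 2 (viewing G = V \ {0}) such that (W \ {0}) ∩ E = ∅. -/
/-- Triangle-freeness: no distinct `x, y ∈ E` with `x + y ∈ E`. -/
def TriFree {V : Type*} [AddCommGroup V] [Module (ZMod 2) V] (E : Set V) : Prop :=
  ¬ ∃ x ∈ E, ∃ y ∈ E, x ≠ y ∧ x + y ∈ E

section BinaryMatroid

variable {V : Type*} [AddCommGroup V] {E : Set V} {a b c d e u v w t x y : V}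

/-- `E` contains neither zero nor the sum of two of its members. -/
def SumFree (E : Set V) : Prop :=
  ∀ u ∈ E, ∀ v ∈ E, u + v ∉ E

/-- Any four members of `E`, distinct or not, have three whose sum lies in `E`,
or their total lies in `E`. -/
def FourSum (E : Set V) : Prop :=
  ∀ u ∈ E, ∀ v ∈ E, ∀ w ∈ E, ∀ t ∈ E,
    u + v + w ∈ E ∨ u + v + t ∈ E ∨ u + w + t ∈ E ∨ v + w + t ∈ E ∨ u + v + w + t ∈ E

/-- A five-element circuit contained in `E`. -/
structure Pentagon (E : Set V) (a b c d e : V) : Prop where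
  mem_a : a ∈ E
  mem_b : b ∈ E
  mem_c : c ∈ E
  mem_d : d ∈ E
  mem_e : e ∈ E
  eq_sum : e = a + b + c + d

/-- The translate by `v` of the pentagon `a, b, c, d, e` is contained in `E`. -/
def Hub (E : Set V) (a b c d e v : V) : Prop :=
  v + a ∈ E ∧ v + b ∈ E ∧ v + c ∈ E ∧ v + d ∈ E ∧ v + e ∈ E

/-- `x` lies in a translate of the pentagon `a, b, c, d, e` contained in `E`. -/
def Spoke (E : Set V) (a b c d e x : V) : Prop :=
  Hub E a b c d e (x + a) ∨ Hub E a b c d e (x + b) ∨ Hub E a b c d e (x + c) ∨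
    Hub E a b c d e (x + d) ∨ Hub E a b c d e (x + e)

/-- The nonzero even combinations of `a, b, c` translate `x` into `E`. -/
def Tri (E : Set V) (a b c x : V) : Prop :=
  x + (a + b) ∈ E ∧ x + (a + c) ∈ E ∧ x + (b + c) ∈ E

/-- At least three of `x + a`, `x + b`, `x + c`, `x + a + b + c` belong to `E`. -/
def Apex (E : Set V) (a b c x : V) : Prop :=
  (x + a ∈ E ∧ x + b ∈ E ∧ x + c ∈ E) ∨ (x + a ∈ E ∧ x + b ∈ E ∧ x + (a + b + c) ∈ E) ∨
    (x + a ∈ E ∧ x + c ∈ E ∧ x + (a + b + c) ∈ E) ∨ (x + b ∈ E ∧ x + c ∈ E ∧ x + (a + b + c) ∈ E)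

theorem Pentagon.swap_ab (hP : Pentagon E a b c d e) : Pentagon E b a c d e :=
  ⟨hP.mem_b, hP.mem_a, hP.mem_c, hP.mem_d, hP.mem_e, by rw [hP.eq_sum, add_comm a b]⟩

theorem Pentagon.swap_bc (hP : Pentagon E a b c d e) : Pentagon E a c b d e :=
  ⟨hP.mem_a, hP.mem_c, hP.mem_b, hP.mem_d, hP.mem_e, by rw [hP.eq_sum, add_right_comm a b c]⟩

theorem Pentagon.swap_cd (hP : Pentagon E a b c d e) : Pentagon E a b d c e :=
  ⟨hP.mem_a, hP.mem_b, hP.mem_d, hP.mem_c, hP.mem_e, by rw [hP.eq_sum, add_right_comm _ c d]⟩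

theorem Tri.swap_ab (h : Tri E a b c x) : Tri E b a c x :=
  ⟨add_comm a b ▸ h.1, h.2.2, h.2.1⟩

theorem Tri.swap_bc (h : Tri E a b c x) : Tri E a c b x :=
  ⟨h.2.1, h.1, add_comm b c ▸ h.2.2⟩

theorem Hub.rotate (hu : Hub E a b c d e u) : Hub E b c d e a u :=
  ⟨hu.2.1, hu.2.2.1, hu.2.2.2.1, hu.2.2.2.2, hu.1⟩

/-- All of `x + a`, `x + b`, `x + c`, `x + a + b + c` belong to `E`. -/
def FullApex (E : Set V) (a b c x : V) : Prop :=
  x + a ∈ E ∧ x + b ∈ E ∧ x + c ∈ E ∧ x + (a + b + c) ∈ E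

theorem FullApex.apex (hx : FullApex E a b c x) : Apex E a b c x :=
  Or.inl ⟨hx.1, hx.2.1, hx.2.2.1⟩

theorem Hub.apex (hx : Hub E a b c d e x) : Apex E a b c x :=
  Or.inl ⟨hx.1, hx.2.1, hx.2.2.1⟩

theorem SumFree.notMem_of_apex (hT : SumFree E) (ha : a ∈ E) (hb : b ∈ E) (hx : Apex E a b c x) :
    x ∉ E := fun h ↦ by
  have := hT _ h _ ha
  have := hT _ h _ hb
  grind [Apex]

/-- If no pentagon exists, no even-length sum of members of `E` lies in `E`. -/
theorem FourSum.list_sum_notMem (hI : FourSum E) (hT : SumFree E) (h0 : (0 : V) ∉ E)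
    (hP : ∀ a b c d e, ¬ Pentagon E a b c d e) :
    ∀ l : List V, (∀ y ∈ l, y ∈ E) → Even l.length → l.sum ∉ E
  | [], _, _ => by simpa using h0
  | [u], _, h => by simp at h
  | [u, v], h, _ => by simpa using hT u (h u (by simp)) v (h v (by simp))
  | [u, v, w], _, h => absurd h (by simp [Nat.even_add_one])
  | u :: v :: w :: t :: l, h, hl => by
    simp only [List.forall_mem_cons] at h
    obtain ⟨hu, hv, hw, ht, h⟩ := h
    have step {r s x : V} (hr : r ∈ E) (hs : s ∈ E) (hx : x = r + (s + l.sum)) : x ∉ E := by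
      have := list_sum_notMem hI hT h0 hP (r :: s :: l)
        (by simpa only [List.forall_mem_cons] using ⟨hr, hs, h⟩)
        (by simpa [Nat.even_add_one] using hl)
      simpa [hx] using this
    simp only [List.sum_cons]
    obtain i | i | i | i | i := hI u hu v hv w hw t ht
    · exact step i ht (by abel)
    · exact step i hw (by abel)
    · exact step i hv (by abel)
    · exact step i hu (by abel)
    · exact (hP u v w t _ ⟨hu, hv, hw, ht, i, rfl⟩).elim
termination_by l => l.length

variable [Module (ZMod 2) V]

theorem add_self_add_cancel (x y : V) : x + (x + y) = y := by
  rw [← add_assoc, ZModModule.add_self, zero_add]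

theorem Pentagon.spoke_or_tri (hP : Pentagon E a b c d e) (hT : SumFree E) (hI : FourSum E)
    (hx : x ∈ E) :
    Spoke E a b c d e x ∨ Tri E a b c x ∨ Tri E a b d x ∨ Tri E a b e x ∨ Tri E a c d x ∨
      Tri E a c e x ∨ Tri E a d e x ∨ Tri E b c d x ∨ Tri E b c e x ∨ Tri E b d e x ∨
      Tri E c d e x := by
  obtain ⟨ha, hb, hc, hd, he, rfl⟩ := hP
  have i1 := hI x hx a ha b hb c hc
  have i2 := hI x hx a ha b hb d hd
  have i3 := hI x hx a ha b hb _ he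
  have i4 := hI x hx a ha c hc d hd
  have i5 := hI x hx a ha c hc _ he
  have i6 := hI x hx a ha d hd _ he
  have i7 := hI x hx b hb c hc d hd
  have i8 := hI x hx b hb c hc _ he
  have i9 := hI x hx b hb d hd _ he
  have i10 := hI x hx c hc d hd _ he
  have nde := hT _ hd _ he
  have nce := hT _ hc _ he
  have nbe := hT _ hb _ he
  have nae := hT _ ha _ he
  have nab := hT _ ha _ hb
  have nac := hT _ ha _ hc
  have nad := hT _ ha _ hd
  have nbc := hT _ hb _ hc
  have nbd := hT _ hb _ hd
  have ncd := hT _ hc _ hd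
  have tab (h : x + (a + b) ∈ E) := And.intro (hT _ h _ hc) (And.intro (hT _ h _ hd) (hT _ h _ he))
  have tac (h : x + (a + c) ∈ E) := And.intro (hT _ h _ hb) (And.intro (hT _ h _ hd) (hT _ h _ he))
  have tad (h : x + (a + d) ∈ E) := And.intro (hT _ h _ hb) (And.intro (hT _ h _ hc) (hT _ h _ he))
  have tbc (h : x + (b + c) ∈ E) := And.intro (hT _ h _ ha) (And.intro (hT _ h _ hd) (hT _ h _ he))
  have tbd (h : x + (b + d) ∈ E) := And.intro (hT _ h _ ha) (And.intro (hT _ h _ hc) (hT _ h _ he))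
  have tcd (h : x + (c + d) ∈ E) := And.intro (hT _ h _ ha) (And.intro (hT _ h _ hb) (hT _ h _ he))
  clear hT hI
  simp only [Spoke, Hub, Tri, add_left_comm, add_comm, add_self_add_cancel,
    ZModModule.add_self, add_zero] at *
  grind

/-- A member of `E` cannot be a `Tri` for two triples sharing two elements. -/
theorem Pentagon.not_tri_of_tri (hP : Pentagon E a b c d e) (hT : SumFree E) (hI : FourSum E)
    (hx : x ∈ E) (hxt : Tri E a b c x) (hy : y ∈ E) : ¬ Tri E a b d y := by
  rintro ⟨hy₁, hy₂, hy₃⟩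
  obtain ⟨hx₁, hx₂, hx₃⟩ := hxt
  obtain ⟨ha, hb, hc, hd, he, rfl⟩ := hP
  have i := hI x hx _ hx₃ y hy _ hy₃
  have n₁ := hT _ hy₂ _ he
  have n₂ := hT _ hy₁ _ he
  have n₃ := hT _ hx₂ _ he
  have n₄ := hT _ hx₁ _ he
  have n₅ := hT _ hc _ hd
  clear hT hI
  simp only [add_left_comm, add_comm, add_self_add_cancel, ZModModule.add_self, add_zero] at *
  grind

theorem Pentagon.not_tri_of_tri' (hP : Pentagon E a b c d e) (hT : SumFree E) (hI : FourSum E)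
    (hx : x ∈ E) (hxt : Tri E a b c x) (hy : y ∈ E) : ¬ Tri E a d e y := by
  rintro ⟨hy₁, hy₂, hy₃⟩
  obtain ⟨hx₁, hx₂, hx₃⟩ := hxt
  obtain ⟨ha, hb, hc, hd, he, rfl⟩ := hP
  have i := hI x hx _ hx₁ y hy _ hy₁
  have n₁ := hT _ hy₃ _ hc
  have n₂ := hT _ hy₂ _ hc
  have n₃ := hT _ hx₃ _ he
  have n₄ := hT _ hx₂ _ he
  have n₅ := hT _ hb _ hd
  clear hT hI
  simp only [add_left_comm, add_comm, add_self_add_cancel, ZModModule.add_self, add_zero] at *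
  grind

theorem Pentagon.add_mem_of_hub (hP : Pentagon E a b c d e) (hT : SumFree E) (hI : FourSum E)
    (hu : Hub E a b c d e u) (hv : Hub E a b c d e v) : u + v + e ∈ E := by
  obtain ⟨hua, hub, huc, hud, hue⟩ := hu
  obtain ⟨hva, hvb, hvc, hvd, hve⟩ := hv
  obtain ⟨ha, hb, hc, hd, he, rfl⟩ := hP
  have i := hI _ hua _ hvb _ hc _ hd
  have n₁ := hT _ hud _ hve
  have n₂ := hT _ huc _ hve
  have n₃ := hT _ hub _ he
  have n₄ := hT _ hva _ he
  clear hT hI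
  simp only [add_left_comm, add_comm, add_self_add_cancel] at *
  grind

theorem Pentagon.swap_de (hP : Pentagon E a b c d e) : Pentagon E a b c e d := by
  obtain ⟨ha, hb, hc, hd, he, rfl⟩ := hP
  refine ⟨ha, hb, hc, he, hd, ?_⟩
  simp only [add_left_comm, add_comm, add_self_add_cancel]

theorem Pentagon.rotate (hP : Pentagon E a b c d e) : Pentagon E b c d e a := by
  obtain ⟨ha, hb, hc, hd, he, rfl⟩ := hP
  refine ⟨hb, hc, hd, he, ha, ?_⟩
  simp only [add_left_comm, add_comm, ZModModule.add_self, add_zero]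

theorem Pentagon.hub_add (hP : Pentagon E a b c d e) (hT : SumFree E) (hI : FourSum E)
    (hu : Hub E a b c d e u) (hv : Hub E a b c d e v) : Hub E a b c d e (u + v) :=
  ⟨hP.rotate.add_mem_of_hub hT hI hu.rotate hv.rotate,
    hP.rotate.rotate.add_mem_of_hub hT hI hu.rotate.rotate hv.rotate.rotate,
    hP.rotate.rotate.rotate.add_mem_of_hub hT hI hu.rotate.rotate.rotate hv.rotate.rotate.rotate,
    hP.rotate.rotate.rotate.rotate.add_mem_of_hub hT hI hu.rotate.rotate.rotate.rotate
      hv.rotate.rotate.rotate.rotate,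
    hP.add_mem_of_hub hT hI hu hv⟩

theorem Apex.of_add_even {s : V} (hs : s = 0 ∨ s = a + b ∨ s = a + c ∨ s = b + c)
    (h : Apex E a b c (x + s)) : Apex E a b c x := by
  rcases hs with rfl | rfl | rfl | rfl <;>
  · simp only [Apex, add_left_comm, add_comm, add_self_add_cancel, add_zero] at *
    grind

theorem Pentagon.full_or_hub_of_apex (hP : Pentagon E a b c d e) (hT : SumFree E)
    (hall : ∀ y ∈ E, Spoke E a b c d e y ∨ Tri E a b c y) (hx : Apex E a b c x) :
    FullApex E a b c x ∨
      ∃ s, (s = 0 ∨ s = a + b ∨ s = a + c ∨ s = b + c) ∧ Hub E a b c d e (x + s) := by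
  have pa := hall (x + a)
  have pb := hall (x + b)
  have ta (h : x + a ∈ E) := And.intro (hT _ h _ hP.mem_b) (hT _ h _ hP.mem_c)
  have tb (h : x + b ∈ E) := And.intro (hT _ h _ hP.mem_a) (hT _ h _ hP.mem_c)
  have tc (h : x + c ∈ E) := And.intro (hT _ h _ hP.mem_a) (hT _ h _ hP.mem_b)
  simp only [or_and_right, exists_or, exists_eq_left]
  clear hall hT
  obtain ⟨-, -, -, -, -, rfl⟩ := hP
  simp only [FullApex, Apex, Spoke, Tri, Hub, add_left_comm, add_comm,
    add_self_add_cancel, add_zero] at *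
  rcases hx with h | h | h | h <;> grind

theorem Pentagon.fullApex_add (hP : Pentagon E a b c d e) (hT : SumFree E) (hI : FourSum E)
    (hu : Hub E a b c d e u) (hx : FullApex E a b c x) : FullApex E a b c (u + x) := by
  obtain ⟨hua, hub, huc, hud, hue⟩ := hu
  obtain ⟨hxa, hxb, hxc, hxs⟩ := hx
  obtain ⟨ha, hb, hc, hd, he, rfl⟩ := hP
  have i₁ := hI _ hua _ hxa _ hd _ he
  have i₂ := hI _ hua _ hxb _ hd _ he
  have i₃ := hI _ hua _ hxc _ hd _ he
  have i₄ := hI _ hua _ hxs _ hd _ he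
  have n₁ := hT _ hud _ hxa
  have n₂ := hT _ hud _ hxb
  have n₃ := hT _ hud _ hxc
  have n₄ := hT _ hud _ hxs
  have n₅ := hT _ hue _ hxa
  have n₆ := hT _ hue _ hxb
  have n₇ := hT _ hue _ hxc
  have n₈ := hT _ hue _ hxs
  have n₉ := hT _ hub _ hc
  have m₁ := hT _ hxc _ hb
  have m₂ := hT _ hxc _ ha
  have m₃ := hT _ hxb _ ha
  have m₄ := hT _ hxa _ ha
  clear hT hI
  simp only [FullApex, add_left_comm, add_comm, add_self_add_cancel] at *
  grind

theorem Pentagon.apex_add_of_fullApex (hP : Pentagon E a b c d e) (hT : SumFree E)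
    (hI : FourSum E) (hall : ∀ y ∈ E, Spoke E a b c d e y ∨ Tri E a b c y)
    (hx : FullApex E a b c x) (hy : FullApex E a b c y) : Apex E a b c (x + y) := by
  obtain ⟨hxa, hxb, hxc, hxs⟩ := hx
  obtain ⟨hya, hyb, hyc, hys⟩ := hy
  obtain ⟨ha, hb, hc, hd, he, rfl⟩ := hP
  have n₁ := hT _ hxa _ hya
  have n₂ := hT _ hxa _ hyb
  have n₃ := hT _ hxa _ hyc
  have n₄ := hT _ hxa _ hys
  have key : x + y + a ∈ E ∨ x + y + d ∈ E ∨ x + y + (a + d) ∈ E := by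
    have i := hI _ hxa _ hya _ ha _ hd
    have n₅ := hT _ hxs _ he
    have n₆ := hT _ hys _ he
    clear hT hI hall
    simp only [add_left_comm, add_comm, add_self_add_cancel] at *
    grind
  obtain h | h | h := key
  · have p := hall _ h
    clear hT hI hall
    simp only [Apex, Spoke, Tri, Hub, add_left_comm, add_comm, add_self_add_cancel] at *
    grind
  · have p := (hall _ h).imp_right fun t ↦ And.intro t
      (And.intro (hI _ hxa _ hya _ t.1 _ ha) (hT _ t.2.2 _ he))
    have n₅ := hT _ hc _ he
    have n₆ := hT _ hyc _ he
    have n₇ := hT _ hxc _ he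
    have n₈ := hT _ hb _ hd
    clear hT hI hall
    simp only [Apex, Spoke, Tri, Hub, add_left_comm, add_comm,
      add_self_add_cancel, ZModModule.add_self, add_zero] at *
    grind
  · have p := (hall _ h).imp_right fun t ↦ And.intro t (hI _ hxa _ hya _ t.2.1 _ ha)
    have n₅ := hT _ hc _ hd
    have n₆ := hT _ hyc _ hd
    have n₇ := hT _ hxc _ hd
    have n₈ := hT _ hb _ he
    have n₉ := hT _ h _ hd
    clear hT hI hall
    simp only [Apex, Spoke, Tri, Hub, add_left_comm, add_comm,
      add_self_add_cancel, ZModModule.add_self, add_zero] at *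
    grind

theorem Pentagon.apex_add (hP : Pentagon E a b c d e) (hT : SumFree E)
    (hI : FourSum E) (hall : ∀ y ∈ E, Spoke E a b c d e y ∨ Tri E a b c y)
    (hx : Apex E a b c x) (hy : Apex E a b c y) : Apex E a b c (x + y) := by
  obtain hx | ⟨s, hs, hx⟩ := hP.full_or_hub_of_apex hT hall hx <;>
    obtain hy | ⟨t, ht, hy⟩ := hP.full_or_hub_of_apex hT hall hy
  · exact hP.apex_add_of_fullApex hT hI hall hx hy
  · refine .of_add_even ht ?_
    rw [add_assoc, add_comm]
    exact (hP.fullApex_add hT hI hy hx).apex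
  · refine .of_add_even hs ?_
    rw [add_right_comm]
    exact (hP.fullApex_add hT hI hx hy).apex
  · refine .of_add_even hs (.of_add_even ht ?_)
    rw [add_assoc, add_add_add_comm]
    exact (hP.hub_add hT hI hx hy).apex

theorem Pentagon.exists_apex (hP : Pentagon E a b c d e)
    (hx : x ∈ E) (h : Spoke E a b c d e x ∨ Tri E a b c x) :
    Apex E a b c x ∨ Apex E a b c (x + a) ∨ Apex E a b c (x + d) ∨ Apex E a b c (x + (a + d)) := by
  obtain ⟨-, -, -, -, -, rfl⟩ := hP
  simp only [Apex, Spoke, Tri, Hub, add_left_comm, add_comm, add_self_add_cancel] at *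
  grind

theorem Pentagon.spoke_or_tri_of_tri (hP : Pentagon E a b c d e) (hT : SumFree E) (hI : FourSum E)
    (hx : x ∈ E) (h : Tri E a b c x) : ∀ y ∈ E, Spoke E a b c d e y ∨ Tri E a b c y := by
  intro y hy
  have habd := hP.not_tri_of_tri hT hI hx h hy
  have habe := hP.swap_de.not_tri_of_tri hT hI hx h hy
  have hacd := hP.swap_bc.not_tri_of_tri hT hI hx h.swap_bc hy
  have hace := hP.swap_bc.swap_de.not_tri_of_tri hT hI hx h.swap_bc hy
  have hbcd := hP.swap_ab.swap_bc.not_tri_of_tri hT hI hx h.swap_ab.swap_bc hy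
  have hbce := hP.swap_ab.swap_bc.swap_de.not_tri_of_tri hT hI hx h.swap_ab.swap_bc hy
  have hade := hP.not_tri_of_tri' hT hI hx h hy
  have hbde := hP.swap_ab.not_tri_of_tri' hT hI hx h.swap_ab hy
  have hcde := hP.swap_bc.swap_ab.not_tri_of_tri' hT hI hx h.swap_bc.swap_ab hy
  have := hP.spoke_or_tri hT hI hy
  tauto

theorem Pentagon.exists_forall_spoke_or_tri (hP : Pentagon E a b c d e) (hT : SumFree E)
    (hI : FourSum E) :
    ∃ a b c d e, Pentagon E a b c d e ∧ ∀ y ∈ E, Spoke E a b c d e y ∨ Tri E a b c y := by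
  by_cases hall : ∀ y ∈ E, Spoke E a b c d e y
  · exact ⟨a, b, c, d, e, hP, fun y hy ↦ .inl (hall y hy)⟩
  push Not at hall
  obtain ⟨x, hx, hxs⟩ := hall
  suffices ∃ a b c d e, Pentagon E a b c d e ∧ Tri E a b c x by
    obtain ⟨a, b, c, d, e, hQ, h⟩ := this
    exact ⟨a, b, c, d, e, hQ, hQ.spoke_or_tri_of_tri hT hI hx h⟩
  obtain h | h | h | h | h | h | h | h | h | h := (hP.spoke_or_tri hT hI hx).resolve_left hxs
  · exact ⟨_, _, _, _, _, hP, h⟩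
  · exact ⟨_, _, _, _, _, hP.swap_cd, h⟩
  · exact ⟨_, _, _, _, _, hP.swap_de.swap_cd, h⟩
  · exact ⟨_, _, _, _, _, hP.swap_bc.swap_cd, h⟩
  · exact ⟨_, _, _, _, _, hP.swap_bc.swap_de.swap_cd, h⟩
  · exact ⟨_, _, _, _, _, hP.swap_cd.swap_bc.swap_de.swap_cd, h⟩
  · exact ⟨_, _, _, _, _, hP.rotate, h⟩
  · exact ⟨_, _, _, _, _, hP.rotate.swap_cd, h⟩
  · exact ⟨_, _, _, _, _, hP.rotate.swap_bc.swap_cd, h⟩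
  · exact ⟨_, _, _, _, _, hP.rotate.rotate, h⟩

/-- An additively closed set containing zero is a subspace over the field with two elements. -/
def submoduleOfAddClosed (s : Set V) (h0 : (0 : V) ∈ s) (hadd : ∀ x ∈ s, ∀ y ∈ s, x + y ∈ s) :
    Submodule (ZMod 2) V where
  carrier := s
  zero_mem' := h0
  add_mem' hx hy := hadd _ hx _ hy
  smul_mem' r x hx := by
    obtain rfl | rfl : r = 0 ∨ r = 1 := by decide +revert
    · simpa using h0
    · simpa using hx

open Module in
/-- A subspace `W` avoiding `E` extends by a complement of `W ⊔ span {p, q}` when the latter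
contains `E`. -/
theorem exists_submodule_of_subset_sup_span [FiniteDimensional (ZMod 2) V]
    (W : Submodule (ZMod 2) V) (p q : V) (hW : ∀ x ∈ W, x ∉ E)
    (hE : ∀ x ∈ E, x ∈ W ⊔ Submodule.span (ZMod 2) {p, q}) :
    ∃ W' : Submodule (ZMod 2) V, finrank (ZMod 2) V ≤ finrank (ZMod 2) W' + 2 ∧
      ((W' : Set V) \ {0}) ∩ E = ∅ := by
  set X := W ⊔ Submodule.span (ZMod 2) {p, q} with hX
  obtain ⟨U, hU⟩ := Submodule.exists_isCompl X
  have hWX : W ≤ X := le_sup_left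
  refine ⟨W ⊔ U, ?_, ?_⟩
  · have h₁ := Submodule.finrank_add_eq_of_isCompl hU
    have h₂ := Submodule.finrank_sup_add_finrank_inf_eq W U
    rw [(hU.disjoint.mono_left hWX).eq_bot, finrank_bot] at h₂
    have h₃ := Submodule.finrank_add_le_finrank_add_finrank W (Submodule.span (ZMod 2) {p, q})
    have h₄ : finrank (ZMod 2) (Submodule.span (ZMod 2) {p, q}) ≤ 2 := by
      classical
      have := finrank_span_finset_le_card (R := ZMod 2) ({p, q} : Finset V)
      rw [Finset.coe_pair] at this
      exact this.trans Finset.card_le_two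
    rw [← hX] at h₃
    omega
  · rw [Set.eq_empty_iff_forall_notMem]
    rintro x ⟨⟨hx, -⟩, hxE⟩
    refine hW x ?_ hxE
    have : x ∈ (W ⊔ U) ⊓ X := ⟨hx, hE x hxE⟩
    rwa [sup_inf_assoc_of_le U hWX, hU.symm.inf_eq_bot, sup_bot_eq] at this

theorem Pentagon.exists_submodule [FiniteDimensional (ZMod 2) V] (hP : Pentagon E a b c d e)
    (hT : SumFree E) (hI : FourSum E) :
    ∃ W : Submodule (ZMod 2) V, Module.finrank (ZMod 2) V ≤ Module.finrank (ZMod 2) W + 2 ∧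
      ((W : Set V) \ {0}) ∩ E = ∅ := by
  obtain ⟨a, b, c, d, e, hP, hall⟩ := hP.exists_forall_spoke_or_tri hT hI
  let W : Submodule (ZMod 2) V := submoduleOfAddClosed {x | Apex E a b c x}
    (.inl (by simpa using ⟨hP.mem_a, hP.mem_b, hP.mem_c⟩))
    fun x hx y hy ↦ hP.apex_add hT hI hall hx hy
  have hmem {x s : V} (hx : Apex E a b c (x + s)) (hs : s ∈ Submodule.span (ZMod 2) {a, d}) :
      x ∈ W ⊔ Submodule.span (ZMod 2) {a, d} :=
    Submodule.mem_sup.2 ⟨x + s, hx, s, hs, by rw [add_assoc, ZModModule.add_self, add_zero]⟩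
  have ha : a ∈ Submodule.span (ZMod 2) {a, d} := Submodule.subset_span (by simp)
  have hd : d ∈ Submodule.span (ZMod 2) {a, d} := Submodule.subset_span (by simp)
  refine exists_submodule_of_subset_sup_span W a d
    (fun x hx ↦ hT.notMem_of_apex hP.mem_a hP.mem_b hx) fun x hx ↦ ?_
  obtain h | h | h | h := hP.exists_apex hx (hall x hx)
  · exact Submodule.mem_sup_left h
  · exact hmem h ha
  · exact hmem h hd
  · exact hmem h (add_mem ha hd)

theorem exists_submodule_of_forall_not_pentagon [FiniteDimensional (ZMod 2) V] (hI : FourSum E)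
    (hT : SumFree E) (h0 : (0 : V) ∉ E) (hP : ∀ a b c d e, ¬ Pentagon E a b c d e) :
    ∃ W : Submodule (ZMod 2) V, Module.finrank (ZMod 2) V ≤ Module.finrank (ZMod 2) W + 2 ∧
      ((W : Set V) \ {0}) ∩ E = ∅ := by
  obtain rfl | ⟨p, hp⟩ := E.eq_empty_or_nonempty
  · exact ⟨⊤, by simp, by simp⟩
  let W : Submodule (ZMod 2) V := submoduleOfAddClosed
    {x | ∃ l : List V, (∀ y ∈ l, y ∈ E) ∧ Even l.length ∧ l.sum = x} ⟨[], by simp⟩ <| by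
      rintro _ ⟨l, hl, hl', rfl⟩ _ ⟨m, hm, hm', rfl⟩
      refine ⟨l ++ m, fun y hy ↦ ?_, ?_, List.sum_append⟩
      · exact (List.mem_append.1 hy).elim (hl y) (hm y)
      · rw [List.length_append]
        exact hl'.add hm'
  refine exists_submodule_of_subset_sup_span W p p ?_ fun x hx ↦ ?_
  · rintro _ ⟨l, hl, hl', rfl⟩
    exact hI.list_sum_notMem hT h0 hP l hl hl'
  · refine Submodule.mem_sup.2 ⟨x + p, ⟨[x, p], ?_, by simp, by simp⟩, p,
      Submodule.subset_span (by simp), ?_⟩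
    · simpa using ⟨hx, hp⟩
    · rw [add_assoc, ZModModule.add_self, add_zero]

theorem TriFree.sumFree (htri : TriFree E) (h0 : (0 : V) ∉ E) : SumFree E := by
  intro u hu v hv h
  obtain rfl | huv := eq_or_ne u v
  · exact h0 (ZModModule.add_self u ▸ h)
  · exact htri ⟨u, hu, v, hv, huv, h⟩

theorem SumFree.fourSum (hT : SumFree E) (h0 : (0 : V) ∉ E)
    (hI4 : ∀ W : Submodule (ZMod 2) V, Module.finrank (ZMod 2) W = 4 → ¬ MeetsInBasis E W) :
    FourSum E := by
  intro u hu v hv w hw t ht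
  by_contra! hn
  obtain ⟨hn₁, hn₂, hn₃, hn₄, hn₅⟩ := hn
  have zero_or_one : ∀ r : ZMod 2, r = 0 ∨ r = 1 := by decide
  have eq_of_mem {p q r s : ZMod 2} (h : p • u + q • v + r • w + s • t ∈ E) :
      p • u + q • v + r • w + s • t ∈ Set.range ![u, v, w, t] := by
    have := hT u hu v hv
    have := hT u hu w hw
    have := hT u hu t ht
    have := hT v hv w hw
    have := hT v hv t ht
    have := hT w hw t ht
    rcases zero_or_one p with rfl | rfl <;> rcases zero_or_one q with rfl | rfl <;>
      rcases zero_or_one r with rfl | rfl <;> rcases zero_or_one s with rfl | rfl <;>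
      simp_all
  have eq_zero {p q r s : ZMod 2} (h : p • u + q • v + r • w + s • t = 0) :
      p = 0 ∧ q = 0 ∧ r = 0 ∧ s = 0 := by
    have ne_of_notMem {x y : V} (hy : y ∈ E) (h : x + y ∉ E) : x ≠ 0 := by
      rintro rfl
      exact h (by rwa [zero_add])
    have ne_of_mem {x : V} (h : x ∈ E) : x ≠ 0 := ne_of_mem_of_not_mem h h0
    have := ne_of_mem hu
    have := ne_of_mem hv
    have := ne_of_mem hw
    have := ne_of_mem ht
    have := ne_of_notMem hw hn₁
    have := ne_of_notMem hv (add_right_comm u v w ▸ hn₁)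
    have := ne_of_notMem hv (add_right_comm u v t ▸ hn₂)
    have := ne_of_notMem ht hn₄
    have := ne_of_notMem hw (add_right_comm v w t ▸ hn₄)
    have := ne_of_notMem hu (add_rotate u w t ▸ hn₃)
    have hs {x y : V} (hy : y ∈ E) (hx : x ∉ E) : x + y ≠ 0 := by
      intro h
      rw [← ZModModule.sub_eq_add, sub_eq_zero] at h
      exact hx (h ▸ hy)
    have := hs hw (hT u hu v hv)
    have := hs ht (hT u hu v hv)
    have := hs ht (hT u hu w hw)
    have := hs ht (hT v hv w hw)
    have := hs ht hn₁
    clear ne_of_notMem ne_of_mem hs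
    rcases zero_or_one p with rfl | rfl <;> rcases zero_or_one q with rfl | rfl <;>
      rcases zero_or_one r with rfl | rfl <;> rcases zero_or_one s with rfl | rfl <;>
      simp_all
  have hli : LinearIndependent (ZMod 2) ![u, v, w, t] := by
    rw [Fintype.linearIndependent_iff]
    intro g hg
    simp only [Fin.sum_univ_four] at hg
    obtain ⟨h₁, h₂, h₃, h₄⟩ := eq_zero hg
    intro i
    fin_cases i <;> assumption
  have hsub : Set.range ![u, v, w, t] ⊆ E := by
    rintro _ ⟨i, rfl⟩
    fin_cases i <;> assumption
  have hset : E ∩ ((Submodule.span (ZMod 2) (Set.range ![u, v, w, t]) : Set V) \ {0}) =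
      Set.range ![u, v, w, t] := by
    refine Set.Subset.antisymm ?_ fun x hx ↦
      ⟨hsub hx, Submodule.subset_span hx, ne_of_mem_of_not_mem (hsub hx) h0⟩
    rintro x ⟨hxE, hx, -⟩
    obtain ⟨g, rfl⟩ := (Submodule.mem_span_range_iff_exists_fun (ZMod 2)).1 hx
    simp only [Fin.sum_univ_four] at hxE ⊢
    exact eq_of_mem hxE
  refine hI4 (Submodule.span (ZMod 2) (Set.range ![u, v, w, t])) ?_ ?_
  · rw [finrank_span_eq_card hli, Fintype.card_fin]
  · rw [MeetsInBasis, hset]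
    exact ⟨hli.linearIndepOn_id, rfl⟩

end BinaryMatroid

/-- an `I₄`-free, triangle-free simple binary matroid has critical number at
most 2: there is a subspace of codimension at most 2 whose nonzero vectors avoid `E`. -/
theorem stmt15 {V : Type*} [AddCommGroup V] [Module (ZMod 2) V]
    [FiniteDimensional (ZMod 2) V] (E : Set V) (hE : E ⊆ {v : V | v ≠ 0})
    (hI4 : ∀ W : Submodule (ZMod 2) V, Module.finrank (ZMod 2) W = 4 → ¬ MeetsInBasis E W)
    (htri : TriFree E) :
    ∃ W : Submodule (ZMod 2) V,
      Module.finrank (ZMod 2) V ≤ Module.finrank (ZMod 2) W + 2 ∧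
      ((W : Set V) \ {0}) ∩ E = ∅ := by
  have h0 : (0 : V) ∉ E := fun h ↦ hE h rfl
  have hT := htri.sumFree h0
  have hI := hT.fourSum h0 hI4
  by_cases hP : ∃ a b c d e, Pentagon E a b c d e
  · obtain ⟨a, b, c, d, e, hP⟩ := hP
    exact hP.exists_submodule hT hI
  · push Not at hP
    exact exists_submodule_of_forall_not_pentagon hI hT h0 hP
end
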